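/- arXiv:1510.04711 — 4 statements merged into one kernel-verified Lean document; each statement's English description precedes it below -/
import Mathlib

section
/- Let d ≥ 1, let Q be a positive definite d×d complex matrix, let A_1, …, A_n be nonzero positive semidefinite d×d complex matrices, and let Λ be an m×n real matrix with Λ_{jk} ≥ 0 for all j,k, with Σ_j Λ_{jk} = 1 for every k, and such that every row of Λ contains at least one strictly positive entry. Set B_j = Σ_k Λ_{jk} A_k, and for any matrix X write X̄ = X − (tr(X)/d)·I for its traceless part. Then for every Hermitian d×d matrix C: Σ_j (tr(B̄_j C))² / tr(Q B_j) ≤ Σ_k (tr(Ā_k C))² / tr(Q A_k). -/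
open ComplexOrder

/-- The traceless part of a matrix: `X̄ = X − (tr(X)/d)·I`. -/
noncomputable def matBar {d : ℕ} (X : Matrix (Fin d) (Fin d) ℂ) :
    Matrix (Fin d) (Fin d) ℂ :=
  X - (X.trace / (d : ℂ)) • (1 : Matrix (Fin d) (Fin d) ℂ)

open scoped MatrixOrder Matrix.Norms.L2Operator in
/-- The trace of the product of a positive definite matrix and a nonzero positive semidefinite
matrix is positive. -/
theorem Matrix.PosDef.trace_mul_re_pos {ι : Type*} [Fintype ι] {Q X : Matrix ι ι ℂ}
    (hQ : Q.PosDef) (hX : X.PosSemidef) (hX0 : X ≠ 0) : 0 < (Q * X).trace.re := by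
  classical
  obtain ⟨S, hS, rfl⟩ := CStarAlgebra.isStrictlyPositive_iff_eq_star_mul_self.mp
    hQ.isStrictlyPositive
  obtain ⟨T, rfl⟩ := CStarAlgebra.nonneg_iff_eq_star_mul_self.mp hX.nonneg
  have htrace : (star S * S * (star T * T)).trace =
      ((S * star T).conjTranspose * (S * star T)).trace := by
    rw [← mul_assoc, Matrix.trace_mul_comm, ← Matrix.star_eq_conjTranspose, star_mul, star_star]
    simp only [mul_assoc]
  rw [htrace]
  have hnonneg := (Matrix.posSemidef_conjTranspose_mul_self (S * star T)).trace_nonneg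
  refine (Complex.pos_iff.mp (hnonneg.lt_of_ne fun h => hX0 ?_)).1
  have hST := Matrix.trace_conjTranspose_mul_self_eq_zero_iff.mp h.symm
  rw [hS.mul_right_eq_zero] at hST
  rw [hST, zero_mul]

/-- The weighted Cauchy–Schwarz inequality `(∑ wₖ aₖ)² / ∑ wₖ qₖ ≤ ∑ wₖ aₖ² / qₖ`. -/
theorem sq_sum_mul_div_sum_mul_le {ι : Type*} (s : Finset ι) (w a q : ι → ℝ)
    (hw : ∀ k ∈ s, 0 ≤ w k) (hq : ∀ k ∈ s, 0 < q k) :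
    (∑ k ∈ s, w k * a k) ^ 2 / ∑ k ∈ s, w k * q k ≤ ∑ k ∈ s, w k * (a k ^ 2 / q k) := by
  have hf : ∀ k ∈ s, 0 ≤ w k * (a k ^ 2 / q k) := fun k hk =>
    mul_nonneg (hw k hk) (div_nonneg (sq_nonneg _) (hq k hk).le)
  have hg : ∀ k ∈ s, 0 ≤ w k * q k := fun k hk => mul_nonneg (hw k hk) (hq k hk).le
  refine div_le_of_le_mul₀ (Finset.sum_nonneg hg) (Finset.sum_nonneg hf)
    (Finset.sum_sq_le_sum_mul_sum_of_sq_le_mul s hf hg fun k hk => le_of_eq ?_)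
  have := (hq k hk).ne'
  field_simp

/-- The traceless part is linear over finite real combinations. -/
theorem matBar_sum_smul {d : ℕ} {ι : Type*} (s : Finset ι) (w : ι → ℝ)
    (X : ι → Matrix (Fin d) (Fin d) ℂ) :
    matBar (∑ k ∈ s, w k • X k) = ∑ k ∈ s, w k • matBar (X k) := by
  simp only [matBar, Matrix.trace_sum, Matrix.trace_smul, Finset.sum_div, Finset.sum_smul,
    smul_sub, Finset.sum_sub_distrib, smul_div_assoc, smul_assoc]

/-- Order monotonicity of the superoperator `Ḡ_Q`: for a positive definite `Q`,
nonzero positive semidefinite matrices `A_k`, and a stochastic matrix `Λ` with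
`B_j = Σ_k Λ_{jk} A_k`, for every Hermitian `C`,
`Σ_j (tr(B̄_j C))²/tr(Q B_j) ≤ Σ_k (tr(Ā_k C))²/tr(Q A_k)`. -/
theorem GQbar_order_monotone {d n m : ℕ} (hd : 1 ≤ d)
    (Q : Matrix (Fin d) (Fin d) ℂ) (hQ : Q.PosDef)
    (A : Fin n → Matrix (Fin d) (Fin d) ℂ)
    (hA : ∀ k, (A k).PosSemidef) (hA0 : ∀ k, A k ≠ 0)
    (Λ : Fin m → Fin n → ℝ)
    (hΛ : ∀ j k, 0 ≤ Λ j k)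
    (hcol : ∀ k, ∑ j, Λ j k = 1)
    (hrow : ∀ j, ∃ k, 0 < Λ j k)
    (B : Fin m → Matrix (Fin d) (Fin d) ℂ)
    (hB : ∀ j, B j = ∑ k, Λ j k • A k)
    (C : Matrix (Fin d) (Fin d) ℂ) (hC : C.IsHermitian) :
    ∑ j, ((matBar (B j) * C).trace.re) ^ 2 / (Q * B j).trace.re
      ≤ ∑ k, ((matBar (A k) * C).trace.re) ^ 2 / (Q * A k).trace.re := by
  have hnum (j) : (matBar (B j) * C).trace.re = ∑ k, Λ j k * (matBar (A k) * C).trace.re := by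
    simp [hB, matBar_sum_smul, Finset.sum_mul, Matrix.trace_sum]
  have hden (j) : (Q * B j).trace.re = ∑ k, Λ j k * (Q * A k).trace.re := by
    simp [hB, Finset.mul_sum, Matrix.trace_sum]
  calc
    _ ≤ ∑ j, ∑ k, Λ j k * ((matBar (A k) * C).trace.re ^ 2 / (Q * A k).trace.re) := by
      refine Finset.sum_le_sum fun j _ => ?_
      rw [hnum, hden]
      exact sq_sum_mul_div_sum_mul_le _ _ _ _ (fun k _ => hΛ j k)
        fun k _ => hQ.trace_mul_re_pos (hA k) (hA0 k)
    _ = _ := by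
      rw [Finset.sum_comm]
      simp only [← Finset.sum_mul, hcol, one_mul]
end

section
/- Let {M_{a|x}} be a measurement assemblage on ℂ^d that is compatible: there exist finitely many nonzero positive semidefinite matrices G_λ with Σ_λ G_λ = I and nonnegative numbers p(a|x,λ) with Σ_a p(a|x,λ) = 1 for all x and λ, such that M_{a|x} = Σ_λ p(a|x,λ)·G_λ for all a, x. Then τ({M_{a|x}}) ≤ d and τ̄({M_{a|x}}) ≤ d − 1. -/
open ComplexOrder Matrix

/-- Quadratic form of the superoperator `G({ρ_a})`:
`⟨C, G({ρ_a}) C⟩ = Σ_a (tr(ρ_a C))²/tr(ρ_a)`. -/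
noncomputable def qG {d n : ℕ} (ρ : Fin n → Matrix (Fin d) (Fin d) ℂ)
    (C : Matrix (Fin d) (Fin d) ℂ) : ℝ :=
  ∑ a, ((ρ a * C).trace.re) ^ 2 / (ρ a).trace.re

/-- Quadratic form of the superoperator `Ḡ({ρ_a})`:
`⟨C, Ḡ({ρ_a}) C⟩ = Σ_a (tr(ρ̄_a C))²/tr(ρ_a)`. -/
noncomputable def qGbar {d n : ℕ} (ρ : Fin n → Matrix (Fin d) (Fin d) ℂ)
    (C : Matrix (Fin d) (Fin d) ℂ) : ℝ :=
  ∑ a, ((matBar (ρ a) * C).trace.re) ^ 2 / (ρ a).trace.re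

/-- Given, for each index `x`, the quadratic form `C ↦ ⟨C, G_x C⟩` of a superoperator
`G_x` on Hermitian matrices, `tauGen` is the infimum of `Tr(F)` over all self-adjoint
linear endomorphisms `F` of the real inner product space of Hermitian matrices
(inner product `⟨X,Y⟩ = tr(XY)`) satisfying `F ≥ G_x` for every `x`. -/
noncomputable def tauGen {d : ℕ} {ι : Type} (q : ι → Matrix (Fin d) (Fin d) ℂ → ℝ) : ℝ :=
  sInf { t : ℝ |
    ∃ F : selfAdjoint (Matrix (Fin d) (Fin d) ℂ) →ₗ[ℝ] selfAdjoint (Matrix (Fin d) (Fin d) ℂ),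
      (∀ X Y : selfAdjoint (Matrix (Fin d) (Fin d) ℂ),
        ((X : Matrix (Fin d) (Fin d) ℂ) * (F Y : Matrix (Fin d) (Fin d) ℂ)).trace.re
          = ((F X : Matrix (Fin d) (Fin d) ℂ) * (Y : Matrix (Fin d) (Fin d) ℂ)).trace.re) ∧
      (∀ (x : ι) (C : selfAdjoint (Matrix (Fin d) (Fin d) ℂ)),
        q x (C : Matrix (Fin d) (Fin d) ℂ)
          ≤ ((C : Matrix (Fin d) (Fin d) ℂ) * (F C : Matrix (Fin d) (Fin d) ℂ)).trace.re) ∧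
      LinearMap.trace ℝ (selfAdjoint (Matrix (Fin d) (Fin d) ℂ)) F = t }

/-- `τ({ρ_{a|x}}) = inf{Tr(F) : F self-adjoint, F ≥ G({ρ_{a|x}}_a) for all x}`. -/
noncomputable def tau {d m : ℕ} {n : Fin m → ℕ}
    (ρ : ∀ x, Fin (n x) → Matrix (Fin d) (Fin d) ℂ) : ℝ :=
  tauGen (fun x => qG (ρ x))

/-- `τ̄({ρ_{a|x}}) = inf{Tr(F) : F self-adjoint, F ≥ Ḡ({ρ_{a|x}}_a) for all x}`. -/
noncomputable def tauBar {d m : ℕ} {n : Fin m → ℕ}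
    (ρ : ∀ x, Fin (n x) → Matrix (Fin d) (Fin d) ℂ) : ℝ :=
  tauGen (fun x => qGbar (ρ x))

/-- `τ` is at most the trace of any feasible `F`, provided that the bound is nonnegative
(for an empty index the infimum is the default value `0`). -/
lemma tauGen_le {d : ℕ} {ι : Type} {q : ι → Matrix (Fin d) (Fin d) ℂ → ℝ} {t : ℝ} (ht : 0 ≤ t)
    (F : selfAdjoint (Matrix (Fin d) (Fin d) ℂ) →ₗ[ℝ] selfAdjoint (Matrix (Fin d) (Fin d) ℂ))
    (hsymm : ∀ X Y : selfAdjoint (Matrix (Fin d) (Fin d) ℂ),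
      ((X : Matrix (Fin d) (Fin d) ℂ) * (F Y : Matrix (Fin d) (Fin d) ℂ)).trace.re
        = ((F X : Matrix (Fin d) (Fin d) ℂ) * (Y : Matrix (Fin d) (Fin d) ℂ)).trace.re)
    (hge : ∀ (x : ι) (C : selfAdjoint (Matrix (Fin d) (Fin d) ℂ)),
      q x (C : Matrix (Fin d) (Fin d) ℂ)
        ≤ ((C : Matrix (Fin d) (Fin d) ℂ) * (F C : Matrix (Fin d) (Fin d) ℂ)).trace.re)
    (htr : LinearMap.trace ℝ (selfAdjoint (Matrix (Fin d) (Fin d) ℂ)) F ≤ t) :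
    tauGen q ≤ t := by
  unfold tauGen
  by_cases hb : BddBelow { t : ℝ |
    ∃ F : selfAdjoint (Matrix (Fin d) (Fin d) ℂ) →ₗ[ℝ] selfAdjoint (Matrix (Fin d) (Fin d) ℂ),
      (∀ X Y : selfAdjoint (Matrix (Fin d) (Fin d) ℂ),
        ((X : Matrix (Fin d) (Fin d) ℂ) * (F Y : Matrix (Fin d) (Fin d) ℂ)).trace.re
          = ((F X : Matrix (Fin d) (Fin d) ℂ) * (Y : Matrix (Fin d) (Fin d) ℂ)).trace.re) ∧
      (∀ (x : ι) (C : selfAdjoint (Matrix (Fin d) (Fin d) ℂ)),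
        q x (C : Matrix (Fin d) (Fin d) ℂ)
          ≤ ((C : Matrix (Fin d) (Fin d) ℂ) * (F C : Matrix (Fin d) (Fin d) ℂ)).trace.re) ∧
      LinearMap.trace ℝ (selfAdjoint (Matrix (Fin d) (Fin d) ℂ)) F = t }
  · exact (csInf_le hb ⟨F, hsymm, hge, rfl⟩).trans htr
  · rwa [Real.sInf_of_not_bddBelow hb]

/-- The real linear functional `X ↦ tr(A X)` on Hermitian matrices. -/
noncomputable def traceMulFunctional {d : ℕ} (A : Matrix (Fin d) (Fin d) ℂ) :
    selfAdjoint (Matrix (Fin d) (Fin d) ℂ) →ₗ[ℝ] ℝ where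
  toFun X := (A * (X : Matrix (Fin d) (Fin d) ℂ)).trace.re
  map_add' X Y := by simp [mul_add]
  map_smul' r X := by simp

/-- The superoperator `C ↦ Σ_l (tr(A_l C)/w_l) A_l`. -/
noncomputable def frameOperator {d L : ℕ} (A : Fin L → selfAdjoint (Matrix (Fin d) (Fin d) ℂ))
    (w : Fin L → ℝ) :
    selfAdjoint (Matrix (Fin d) (Fin d) ℂ) →ₗ[ℝ] selfAdjoint (Matrix (Fin d) (Fin d) ℂ) :=
  ∑ l, (w l)⁻¹ • (traceMulFunctional (A l : Matrix (Fin d) (Fin d) ℂ)).smulRight (A l)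

lemma trace_mul_frameOperator {d L : ℕ} (A : Fin L → selfAdjoint (Matrix (Fin d) (Fin d) ℂ))
    (w : Fin L → ℝ) (X Y : selfAdjoint (Matrix (Fin d) (Fin d) ℂ)) :
    ((X : Matrix (Fin d) (Fin d) ℂ) * (frameOperator A w Y : Matrix (Fin d) (Fin d) ℂ)).trace.re
      = ∑ l, ((A l : Matrix (Fin d) (Fin d) ℂ) * (X : Matrix (Fin d) (Fin d) ℂ)).trace.re
          * ((A l : Matrix (Fin d) (Fin d) ℂ) * (Y : Matrix (Fin d) (Fin d) ℂ)).trace.re / w l := by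
  simp only [frameOperator, LinearMap.sum_apply, LinearMap.smul_apply, LinearMap.smulRight_apply,
    AddSubgroup.val_finsetSum, selfAdjoint.val_smul, Finset.mul_sum, Matrix.trace_sum,
    Complex.re_sum, mul_smul_comm, Matrix.trace_smul, Complex.smul_re, traceMulFunctional,
    LinearMap.coe_mk, AddHom.coe_mk, smul_eq_mul]
  refine Finset.sum_congr rfl fun l _ => ?_
  rw [Matrix.trace_mul_comm (X : Matrix (Fin d) (Fin d) ℂ)]
  ring

lemma finite_selfAdjoint_matrix (d : ℕ) :
    Module.Finite ℝ (selfAdjoint (Matrix (Fin d) (Fin d) ℂ)) :=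
  Module.Finite.equiv (LinearEquiv.refl ℝ (selfAdjoint.submodule ℝ (Matrix (Fin d) (Fin d) ℂ)))

lemma trace_frameOperator {d L : ℕ} (A : Fin L → selfAdjoint (Matrix (Fin d) (Fin d) ℂ))
    (w : Fin L → ℝ) :
    LinearMap.trace ℝ _ (frameOperator A w)
      = ∑ l, ((A l : Matrix (Fin d) (Fin d) ℂ) * (A l : Matrix (Fin d) (Fin d) ℂ)).trace.re
          / w l := by
  have := finite_selfAdjoint_matrix d
  simp only [frameOperator, map_sum, map_smul, LinearMap.trace_smulRight, traceMulFunctional,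
    LinearMap.coe_mk, AddHom.coe_mk, smul_eq_mul]
  exact Finset.sum_congr rfl fun l _ => by ring

lemma sum_mul_sq_div_le {L : ℕ} {p w : Fin L → ℝ} (t : Fin L → ℝ) (hp : ∀ l, 0 ≤ p l)
    (hw : ∀ l, 0 < w l) :
    (∑ l, p l * t l) ^ 2 / ∑ l, p l * w l ≤ ∑ l, p l * (t l * t l / w l) := by
  have hf : ∀ l ∈ Finset.univ, 0 ≤ p l * (t l * t l / w l) := fun l _ =>
    mul_nonneg (hp l) (div_nonneg (mul_self_nonneg _) (hw l).le)
  have hg : ∀ l ∈ Finset.univ, 0 ≤ p l * w l := fun l _ => mul_nonneg (hp l) (hw l).le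
  refine div_le_of_le_mul₀ (Finset.sum_nonneg hg) (Finset.sum_nonneg hf) ?_
  refine Finset.sum_sq_le_sum_mul_sum_of_sq_le_mul _ hf hg fun l _ => le_of_eq ?_
  have := (hw l).ne'
  field_simp

/-- The frame operator of a parent family bounds `τ` for every family of its postprocessings. -/
lemma tauGen_le_of_postprocessing {d m L : ℕ} {n : Fin m → ℕ}
    {q : Fin m → Matrix (Fin d) (Fin d) ℂ → ℝ} {t : ℝ} (ht : 0 ≤ t)
    {A : Fin L → Matrix (Fin d) (Fin d) ℂ} (hA : ∀ l, (A l).IsHermitian)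
    {w : Fin L → ℝ} (hw : ∀ l, 0 < w l) {p : ∀ x : Fin m, Fin (n x) → Fin L → ℝ}
    (hp : ∀ x a l, 0 ≤ p x a l) (hp1 : ∀ x l, ∑ a, p x a l = 1)
    (hq : ∀ x C, q x C
      = ∑ a, (∑ l, p x a l * (A l * C).trace.re) ^ 2 / ∑ l, p x a l * w l)
    (htr : ∑ l, (A l * A l).trace.re / w l ≤ t) :
    tauGen q ≤ t := by
  let B : Fin L → selfAdjoint (Matrix (Fin d) (Fin d) ℂ) := fun l => ⟨A l, hA l⟩
  refine tauGen_le ht (frameOperator B w) (fun X Y => ?_) (fun x C => ?_) ?_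
  · rw [Matrix.trace_mul_comm (frameOperator B w X : Matrix (Fin d) (Fin d) ℂ),
      trace_mul_frameOperator, trace_mul_frameOperator]
    exact Finset.sum_congr rfl fun l _ => by rw [mul_comm (Complex.re _)]
  · rw [hq, trace_mul_frameOperator]
    refine (Finset.sum_le_sum fun a _ => sum_mul_sq_div_le _ (hp x a) hw).trans_eq ?_
    rw [Finset.sum_comm]
    refine Finset.sum_congr rfl fun l _ => ?_
    rw [← Finset.sum_mul, hp1, one_mul]
  · rw [trace_frameOperator]
    exact htr

lemma Matrix.PosSemidef.trace_mul_self_le {d : ℕ} {G : Matrix (Fin d) (Fin d) ℂ}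
    (hG : G.PosSemidef) : (G * G).trace.re ≤ G.trace.re ^ 2 := by
  have h : (G * G).trace ≤ G.trace * G.trace := by
    simp only [Matrix.trace, Matrix.diag, Matrix.mul_apply, Finset.sum_mul_sum]
    refine Finset.sum_le_sum fun i _ => Finset.sum_le_sum fun j _ => ?_
    have hdet := (hG.submatrix ![i, j]).det_nonneg
    rw [Matrix.det_fin_two] at hdet
    simpa using hdet
  have him : G.trace.im = 0 := (Complex.nonneg_iff.mp hG.trace_nonneg).2.symm
  simpa [Complex.mul_re, him, sq] using (Complex.le_def.mp h).1

lemma matBar_smul {d : ℕ} (r : ℝ) (X : Matrix (Fin d) (Fin d) ℂ) :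
    matBar (r • X) = r • matBar X := by
  simp only [matBar, Matrix.trace_smul, smul_sub, smul_div_assoc, smul_assoc]

lemma matBar_sum {d L : ℕ} (X : Fin L → Matrix (Fin d) (Fin d) ℂ) :
    matBar (∑ l, X l) = ∑ l, matBar (X l) := by
  simp only [matBar, Matrix.trace_sum, Finset.sum_sub_distrib, Finset.sum_div, Finset.sum_smul]

lemma Matrix.PosSemidef.trace_eq_ofReal {d : ℕ} {G : Matrix (Fin d) (Fin d) ℂ}
    (hG : G.PosSemidef) : G.trace = (G.trace.re : ℂ) :=
  Complex.ext rfl (Complex.nonneg_iff.mp hG.trace_nonneg).2.symm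

lemma Matrix.PosSemidef.isHermitian_matBar {d : ℕ} {G : Matrix (Fin d) (Fin d) ℂ}
    (hG : G.PosSemidef) : (matBar G).IsHermitian := by
  rw [matBar, hG.trace_eq_ofReal]
  refine hG.isHermitian.sub ?_
  simp [Matrix.IsHermitian, Matrix.conjTranspose_smul]

lemma Matrix.PosSemidef.trace_matBar_mul_self {d : ℕ} (hd : d ≠ 0)
    {G : Matrix (Fin d) (Fin d) ℂ} (hG : G.PosSemidef) :
    (matBar G * matBar G).trace.re = (G * G).trace.re - G.trace.re ^ 2 / d := by
  have hd' : (d : ℂ) ≠ 0 := Nat.cast_ne_zero.mpr hd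
  have h : (matBar G * matBar G).trace
      = (G * G).trace - ((G.trace.re ^ 2 / d : ℝ) : ℂ) := by
    simp only [matBar, sub_mul, mul_sub, Matrix.trace_sub, smul_mul_assoc, mul_smul_comm,
      Matrix.trace_smul, one_mul, mul_one, Matrix.trace_one, Fintype.card_fin, smul_eq_mul]
    push_cast
    rw [← hG.trace_eq_ofReal]
    field_simp
    ring
  rw [h, Complex.sub_re, Complex.ofReal_re]

/-- Universal incompatibility inequality: any compatible (jointly measurable) measurement
assemblage `{M_{a|x}}` on `ℂ^d` satisfies `τ({M_{a|x}}) ≤ d` and `τ̄({M_{a|x}}) ≤ d − 1`. -/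
theorem tau_le_of_compatible {d m : ℕ} (hd : 1 ≤ d) {n : Fin m → ℕ}
    (M : ∀ x : Fin m, Fin (n x) → Matrix (Fin d) (Fin d) ℂ)
    (hpsd : ∀ x a, (M x a).PosSemidef) (h0 : ∀ x a, M x a ≠ 0)
    (hsum : ∀ x, ∑ a, M x a = (1 : Matrix (Fin d) (Fin d) ℂ))
    (hcomp : ∃ (L : ℕ) (G : Fin L → Matrix (Fin d) (Fin d) ℂ)
        (p : ∀ x : Fin m, Fin (n x) → Fin L → ℝ),
      (∀ l, (G l).PosSemidef) ∧ (∀ l, G l ≠ 0) ∧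
      (∑ l, G l = (1 : Matrix (Fin d) (Fin d) ℂ)) ∧
      (∀ x a l, 0 ≤ p x a l) ∧ (∀ x l, ∑ a, p x a l = 1) ∧
      (∀ x a, M x a = ∑ l, p x a l • G l)) :
    tau M ≤ d ∧ tauBar M ≤ d - 1 := by
  obtain ⟨L, G, p, hG, hG0, hG1, hp, hp1, hM⟩ := hcomp
  have hd0 : d ≠ 0 := by omega
  have hdpos : (0 : ℝ) < d := by exact_mod_cast hd
  have hw : ∀ l, 0 < (G l).trace.re := fun l =>
    lt_of_le_of_ne (Complex.nonneg_iff.mp (hG l).trace_nonneg).1 fun h => hG0 l <| by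
      rw [← (hG l).trace_eq_zero_iff, (hG l).trace_eq_ofReal, ← h, Complex.ofReal_zero]
  have hwsum : ∑ l, (G l).trace.re = d := by
    rw [← Complex.re_sum, ← Matrix.trace_sum, hG1]
    simp
  have hMtr : ∀ x a, (M x a).trace.re = ∑ l, p x a l * (G l).trace.re := fun x a => by
    simp [hM, Matrix.trace_sum, Matrix.trace_smul]
  constructor
  · refine tauGen_le_of_postprocessing hdpos.le (fun l => (hG l).isHermitian) hw hp hp1
      (fun x C => ?_) ?_
    · refine Finset.sum_congr rfl fun a _ => ?_
      rw [hMtr, hM]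
      simp [Finset.sum_mul, Matrix.trace_sum, Matrix.trace_smul]
    · rw [← hwsum]
      refine Finset.sum_le_sum fun l _ => ?_
      rw [div_le_iff₀ (hw l), ← sq (Complex.re _)]
      exact (hG l).trace_mul_self_le
  · refine tauGen_le_of_postprocessing (sub_nonneg.mpr (by exact_mod_cast hd))
      (fun l => (hG l).isHermitian_matBar) hw hp hp1 (fun x C => ?_) ?_
    · refine Finset.sum_congr rfl fun a _ => ?_
      rw [hMtr, hM, matBar_sum]
      simp [matBar_smul, Finset.sum_mul, Matrix.trace_sum, Matrix.trace_smul]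
    · calc ∑ l, (matBar (G l) * matBar (G l)).trace.re / (G l).trace.re
          ≤ ∑ l, (G l).trace.re * (1 - 1 / d) := by
            refine Finset.sum_le_sum fun l _ => ?_
            rw [div_le_iff₀ (hw l), (hG l).trace_matBar_mul_self hd0]
            linear_combination (hG l).trace_mul_self_le
        _ = d - 1 := by
            rw [← Finset.sum_mul, hwsum]
            field_simp
end

section
/- For any state assemblage {ρ_{a|x}} for a matrix ρ_B, one has τ({ρ_{a|x}}) = τ̄({ρ_{a|x}}) + tr(ρ_B)/d. In particular, if tr(ρ_B) = 1 then τ({ρ_{a|x}}) = τ̄({ρ_{a|x}}) + 1/d, and for any measurement assemblage {M_{a|x}} (where Σ_a M_{a|x} = I, so tr(ρ_B) = d) one has τ({M_{a|x}}) = τ̄({M_{a|x}}) + 1. -/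
open ComplexOrder Matrix

/-- The trace inner product on Hermitian matrices. -/
noncomputable def traceForm (d : ℕ) :
    selfAdjoint (Matrix (Fin d) (Fin d) ℂ) →ₗ[ℝ]
      selfAdjoint (Matrix (Fin d) (Fin d) ℂ) →ₗ[ℝ] ℝ :=
  LinearMap.mk₂ ℝ
    (fun X Y => ((X : Matrix (Fin d) (Fin d) ℂ) * (Y : Matrix (Fin d) (Fin d) ℂ)).trace.re)
    (fun X Y Z => by simp [add_mul])
    (fun c X Y => by simp)
    (fun X Y Z => by simp [mul_add])
    (fun c X Y => by simp)

lemma traceForm_apply {d : ℕ} (X Y : selfAdjoint (Matrix (Fin d) (Fin d) ℂ)) :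
    traceForm d X Y
      = ((X : Matrix (Fin d) (Fin d) ℂ) * (Y : Matrix (Fin d) (Fin d) ℂ)).trace.re := rfl

lemma traceForm_comm {d : ℕ} (X Y : selfAdjoint (Matrix (Fin d) (Fin d) ℂ)) :
    traceForm d X Y = traceForm d Y X := by
  rw [traceForm_apply, traceForm_apply, Matrix.trace_mul_comm]

lemma traceForm_self {d : ℕ} (X : selfAdjoint (Matrix (Fin d) (Fin d) ℂ)) :
    ((traceForm d X X : ℝ) : ℂ)
      = ((X : Matrix (Fin d) (Fin d) ℂ)ᴴ * (X : Matrix (Fin d) (Fin d) ℂ)).trace := by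
  have h : (X : Matrix (Fin d) (Fin d) ℂ)ᴴ = X := X.2
  have h0 := (Matrix.posSemidef_conjTranspose_mul_self (X : Matrix (Fin d) (Fin d) ℂ)).trace_nonneg
  have h1 := (Complex.nonneg_iff.mp h0).2
  rw [traceForm_apply]
  apply Complex.ext
  · simp [h]
  · simpa using h1

lemma traceForm_self_nonneg {d : ℕ} (X : selfAdjoint (Matrix (Fin d) (Fin d) ℂ)) :
    0 ≤ traceForm d X X := by
  have h0 := (Matrix.posSemidef_conjTranspose_mul_self (X : Matrix (Fin d) (Fin d) ℂ)).trace_nonneg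
  rw [← traceForm_self] at h0
  exact_mod_cast h0

lemma eq_zero_of_traceForm_self {d : ℕ} (X : selfAdjoint (Matrix (Fin d) (Fin d) ℂ))
    (h : traceForm d X X = 0) : X = 0 := by
  have h0 := traceForm_self X
  rw [h, Complex.ofReal_zero, eq_comm, Matrix.trace_conjTranspose_mul_self_eq_zero_iff] at h0
  exact Subtype.ext h0

lemma LinearMap.trace_nonneg_of_inner_nonneg {E : Type*} [NormedAddCommGroup E]
    [InnerProductSpace ℝ E] [FiniteDimensional ℝ E] (T : E →ₗ[ℝ] E)
    (h : ∀ x, 0 ≤ inner ℝ x (T x)) : 0 ≤ LinearMap.trace ℝ E T := by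
  rw [LinearMap.trace_eq_sum_inner T (stdOrthonormalBasis ℝ E)]
  exact Finset.sum_nonneg fun i _ => h _

/-- The trace inner product as an inner product space core. -/
@[reducible] noncomputable def traceFormCore (d : ℕ) :
    InnerProductSpace.Core ℝ (selfAdjoint (Matrix (Fin d) (Fin d) ℂ)) where
  inner X Y := traceForm d X Y
  conj_inner_symm X Y := traceForm_comm Y X
  re_inner_nonneg X := traceForm_self_nonneg X
  add_left X Y Z := by simp
  smul_left X Y c := by simp
  definite X := eq_zero_of_traceForm_self X

lemma trace_nonneg_of_traceForm_nonneg {d : ℕ}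
    (F : selfAdjoint (Matrix (Fin d) (Fin d) ℂ) →ₗ[ℝ] selfAdjoint (Matrix (Fin d) (Fin d) ℂ))
    (h : ∀ C, 0 ≤ traceForm d C (F C)) :
    0 ≤ LinearMap.trace ℝ (selfAdjoint (Matrix (Fin d) (Fin d) ℂ)) F := by
  have : FiniteDimensional ℝ (Matrix (Fin d) (Fin d) ℂ) := .trans ℝ ℂ _
  have : FiniteDimensional ℝ (selfAdjoint (Matrix (Fin d) (Fin d) ℂ)) :=
    FiniteDimensional.finiteDimensional_submodule
      (selfAdjoint.submodule ℝ (Matrix (Fin d) (Fin d) ℂ))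
  let := (traceFormCore d).toNormedAddCommGroup
  let := InnerProductSpace.ofCore (traceFormCore d).toCore
  exact LinearMap.trace_nonneg_of_inner_nonneg F h

/-- The superoperator `C ↦ tr(A C) B`. -/
noncomputable def rankOneMap {d : ℕ} (A B : selfAdjoint (Matrix (Fin d) (Fin d) ℂ)) :
    selfAdjoint (Matrix (Fin d) (Fin d) ℂ) →ₗ[ℝ] selfAdjoint (Matrix (Fin d) (Fin d) ℂ) :=
  (traceForm d A).smulRight B

lemma traceForm_rankOneMap {d : ℕ} (A B X Y : selfAdjoint (Matrix (Fin d) (Fin d) ℂ)) :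
    traceForm d X (rankOneMap A B Y) = traceForm d A Y * traceForm d B X := by
  simp [rankOneMap, traceForm_comm X]

lemma trace_rankOneMap {d : ℕ} (A B : selfAdjoint (Matrix (Fin d) (Fin d) ℂ)) :
    LinearMap.trace ℝ _ (rankOneMap A B) = traceForm d A B := by
  have : FiniteDimensional ℝ (Matrix (Fin d) (Fin d) ℂ) := .trans ℝ ℂ _
  have : FiniteDimensional ℝ (selfAdjoint (Matrix (Fin d) (Fin d) ℂ)) :=
    FiniteDimensional.finiteDimensional_submodule
      (selfAdjoint.submodule ℝ (Matrix (Fin d) (Fin d) ℂ))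
  exact LinearMap.trace_smulRight _ _

/-- `F` is self-adjoint and dominates every quadratic form `q x`. -/
def IsDominating {d : ℕ} {ι : Type} (q : ι → Matrix (Fin d) (Fin d) ℂ → ℝ)
    (F : selfAdjoint (Matrix (Fin d) (Fin d) ℂ) →ₗ[ℝ]
      selfAdjoint (Matrix (Fin d) (Fin d) ℂ)) : Prop :=
  (∀ X Y, traceForm d X (F Y) = traceForm d (F X) Y) ∧
    ∀ (x : ι) (C : selfAdjoint (Matrix (Fin d) (Fin d) ℂ)),
      q x (C : Matrix (Fin d) (Fin d) ℂ) ≤ traceForm d C (F C)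

lemma tauGen_eq {d : ℕ} {ι : Type} (q : ι → Matrix (Fin d) (Fin d) ℂ → ℝ) :
    tauGen q = sInf (LinearMap.trace ℝ _ '' {F | IsDominating q F}) := by
  simp only [tauGen, Set.image, IsDominating, Set.mem_ofPred_eq, and_assoc]
  rfl

lemma IsDominating.add {d : ℕ} {ι : Type} {q q' : ι → Matrix (Fin d) (Fin d) ℂ → ℝ}
    {F K : selfAdjoint (Matrix (Fin d) (Fin d) ℂ) →ₗ[ℝ] selfAdjoint (Matrix (Fin d) (Fin d) ℂ)}
    (hF : IsDominating q F) (hK : ∀ X Y, traceForm d X (K Y) = traceForm d (K X) Y)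
    (hq : ∀ (x : ι) (C : selfAdjoint (Matrix (Fin d) (Fin d) ℂ)),
      q' x (C : Matrix (Fin d) (Fin d) ℂ) = q x C + traceForm d C (K C)) :
    IsDominating q' (F + K) := by
  refine ⟨fun X Y => ?_, fun x C => ?_⟩
  · simp [hF.1 X Y, hK X Y]
  · rw [hq, LinearMap.add_apply, map_add]
    exact add_le_add_left (hF.2 x C) _

/-- Adding a fixed self-adjoint superoperator `K` to every constraint shifts the infimum
by `Tr(K)`. -/
lemma tauGen_eq_add {d : ℕ} {ι : Type} [Nonempty ι]
    {q q' : ι → Matrix (Fin d) (Fin d) ℂ → ℝ}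
    {K : selfAdjoint (Matrix (Fin d) (Fin d) ℂ) →ₗ[ℝ] selfAdjoint (Matrix (Fin d) (Fin d) ℂ)}
    (hK : ∀ X Y, traceForm d X (K Y) = traceForm d (K X) Y)
    (hq : ∀ (x : ι) (C : selfAdjoint (Matrix (Fin d) (Fin d) ℂ)),
      q' x (C : Matrix (Fin d) (Fin d) ℂ) = q x C + traceForm d C (K C))
    (hq0 : ∀ x C, 0 ≤ q x C) (hne : ∃ F, IsDominating q' F) :
    tauGen q' = tauGen q + LinearMap.trace ℝ _ K := by
  have hback : ∀ F, IsDominating q' F → IsDominating q (F - K) := fun F hF => by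
    rw [sub_eq_add_neg]
    exact hF.add (fun X Y => by simp [hK X Y]) (fun x C => by simp [hq x C])
  have himage : LinearMap.trace ℝ _ '' {F | IsDominating q' F}
      = (fun t => t + LinearMap.trace ℝ _ K) ''
          (LinearMap.trace ℝ _ '' {F | IsDominating q F}) := by
    ext t
    constructor
    · rintro ⟨F, hF, rfl⟩
      exact ⟨_, ⟨_, hback F hF, rfl⟩, by simp⟩
    · rintro ⟨_, ⟨F, hF, rfl⟩, rfl⟩
      exact ⟨_, hF.add hK hq, by simp⟩
  obtain ⟨F₀, hF₀⟩ := hne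
  have hbdd : BddBelow (LinearMap.trace ℝ _ '' {F | IsDominating q F}) := by
    refine ⟨0, ?_⟩
    rintro _ ⟨F, hF, rfl⟩
    exact trace_nonneg_of_traceForm_nonneg F fun C =>
      (hq0 (Classical.arbitrary ι) C).trans (hF.2 _ C)
  rw [tauGen_eq, tauGen_eq, himage]
  exact ((OrderIso.addRight (LinearMap.trace ℝ _ K)).map_csInf'
    (Set.Nonempty.image _ ⟨F₀ - K, hback F₀ hF₀⟩) hbdd).symm

/-- The superoperator `G({ρ_a})`. -/
noncomputable def opG {d n : ℕ} (ρ : Fin n → selfAdjoint (Matrix (Fin d) (Fin d) ℂ)) :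
    selfAdjoint (Matrix (Fin d) (Fin d) ℂ) →ₗ[ℝ] selfAdjoint (Matrix (Fin d) (Fin d) ℂ) :=
  ∑ a, ((ρ a : Matrix (Fin d) (Fin d) ℂ).trace.re)⁻¹ • rankOneMap (ρ a) (ρ a)

lemma traceForm_opG {d n : ℕ} (ρ : Fin n → selfAdjoint (Matrix (Fin d) (Fin d) ℂ))
    (X Y : selfAdjoint (Matrix (Fin d) (Fin d) ℂ)) :
    traceForm d X (opG ρ Y)
      = ∑ a, ((ρ a : Matrix (Fin d) (Fin d) ℂ).trace.re)⁻¹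
          * (traceForm d (ρ a) Y * traceForm d (ρ a) X) := by
  simp [opG, LinearMap.sum_apply, traceForm_rankOneMap]

lemma traceForm_opG_self {d n : ℕ} (ρ : Fin n → selfAdjoint (Matrix (Fin d) (Fin d) ℂ))
    (C : selfAdjoint (Matrix (Fin d) (Fin d) ℂ)) :
    traceForm d C (opG ρ C) = qG (fun a => (ρ a : Matrix (Fin d) (Fin d) ℂ)) C := by
  rw [traceForm_opG, qG]
  refine Finset.sum_congr rfl fun a _ => ?_
  rw [traceForm_apply, sq, div_eq_inv_mul]

lemma qG_nonneg {d n : ℕ} {ρ : Fin n → Matrix (Fin d) (Fin d) ℂ}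
    (hρ : ∀ a, 0 ≤ (ρ a).trace.re) (C : Matrix (Fin d) (Fin d) ℂ) : 0 ≤ qG ρ C :=
  Finset.sum_nonneg fun a _ => div_nonneg (sq_nonneg _) (hρ a)

lemma qGbar_nonneg {d n : ℕ} {ρ : Fin n → Matrix (Fin d) (Fin d) ℂ}
    (hρ : ∀ a, 0 ≤ (ρ a).trace.re) (C : Matrix (Fin d) (Fin d) ℂ) : 0 ≤ qGbar ρ C :=
  Finset.sum_nonneg fun a _ => div_nonneg (sq_nonneg _) (hρ a)

lemma exists_isDominating_qG {d m : ℕ} {n : Fin m → ℕ}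
    (ρ : ∀ x, Fin (n x) → selfAdjoint (Matrix (Fin d) (Fin d) ℂ))
    (hρ : ∀ x a, 0 ≤ (ρ x a : Matrix (Fin d) (Fin d) ℂ).trace.re) :
    ∃ F, IsDominating (fun x => qG fun a => (ρ x a : Matrix (Fin d) (Fin d) ℂ)) F := by
  refine ⟨∑ x, opG (ρ x), fun X Y => ?_, fun x C => ?_⟩
  · rw [traceForm_comm _ Y]
    simp only [LinearMap.sum_apply, map_sum, traceForm_opG]
    exact Finset.sum_congr rfl fun x _ => Finset.sum_congr rfl fun a _ => by ring
  · simp only [LinearMap.sum_apply, map_sum, traceForm_opG_self]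
    exact Finset.single_le_sum
      (f := fun x => qG (fun a => (ρ x a : Matrix (Fin d) (Fin d) ℂ)) C)
      (fun y _ => qG_nonneg (hρ y) _) (Finset.mem_univ x)

/-- The difference `G({ρ_a}) − Ḡ({ρ_a})`, which depends only on `B = Σ_a ρ_a`. -/
noncomputable def barCorrection {d : ℕ} (B : selfAdjoint (Matrix (Fin d) (Fin d) ℂ)) :
    selfAdjoint (Matrix (Fin d) (Fin d) ℂ) →ₗ[ℝ] selfAdjoint (Matrix (Fin d) (Fin d) ℂ) :=
  (d : ℝ)⁻¹ • (rankOneMap 1 B + rankOneMap B 1)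
    - ((d : ℝ)⁻¹ ^ 2 * traceForm d 1 B) • rankOneMap 1 1

lemma traceForm_one {d : ℕ} (X : selfAdjoint (Matrix (Fin d) (Fin d) ℂ)) :
    traceForm d 1 X = (X : Matrix (Fin d) (Fin d) ℂ).trace.re := by
  simp [traceForm_apply]

lemma traceForm_barCorrection {d : ℕ} (B X Y : selfAdjoint (Matrix (Fin d) (Fin d) ℂ)) :
    traceForm d X (barCorrection B Y)
      = (d : ℝ)⁻¹ * (traceForm d 1 Y * traceForm d B X + traceForm d B Y * traceForm d 1 X)
        - (d : ℝ)⁻¹ ^ 2 * traceForm d 1 B * (traceForm d 1 Y * traceForm d 1 X) := by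
  simp [barCorrection, traceForm_rankOneMap, mul_add]

lemma trace_barCorrection {d : ℕ} (hd : 1 ≤ d) (B : selfAdjoint (Matrix (Fin d) (Fin d) ℂ)) :
    LinearMap.trace ℝ _ (barCorrection B) = (B : Matrix (Fin d) (Fin d) ℂ).trace.re / d := by
  have hd0 : (d : ℝ) ≠ 0 := by positivity
  have h1 : traceForm d 1 1 = d := by simp [traceForm_one]
  simp only [barCorrection, map_sub, map_smul, map_add, trace_rankOneMap, h1,
    traceForm_comm B, traceForm_one, smul_eq_mul]
  field_simp
  ring

lemma trace_matBar_mul_re {d : ℕ} {ρ : Matrix (Fin d) (Fin d) ℂ} (hρ : ρ.trace.im = 0)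
    (C : Matrix (Fin d) (Fin d) ℂ) :
    (matBar ρ * C).trace.re = (ρ * C).trace.re - ρ.trace.re / d * C.trace.re := by
  have h : ρ.trace / (d : ℂ) = ((ρ.trace.re / d : ℝ) : ℂ) := by
    rw [← Complex.re_add_im ρ.trace, hρ]
    simp
  simp [matBar, sub_mul, h, -Complex.ofReal_div]

lemma qG_eq_qGbar_add {d n : ℕ} (ρ : Fin n → Matrix (Fin d) (Fin d) ℂ)
    (hpos : ∀ a, 0 < (ρ a).trace) (B C : selfAdjoint (Matrix (Fin d) (Fin d) ℂ))
    (hB : ∑ a, ρ a = B) :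
    qG ρ C = qGbar ρ C + traceForm d C (barCorrection B C) := by
  have hp : traceForm d B C = ∑ a, (ρ a * (C : Matrix (Fin d) (Fin d) ℂ)).trace.re := by
    rw [traceForm_apply, ← hB, Finset.sum_mul, Matrix.trace_sum, Complex.re_sum]
  have ht : traceForm d 1 B = ∑ a, (ρ a).trace.re := by
    rw [traceForm_one, ← hB, Matrix.trace_sum, Complex.re_sum]
  have hterm : ∀ a, ((ρ a * (C : Matrix (Fin d) (Fin d) ℂ)).trace.re) ^ 2 / (ρ a).trace.re
      = ((matBar (ρ a) * (C : Matrix (Fin d) (Fin d) ℂ)).trace.re) ^ 2 / (ρ a).trace.re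
        + ((d : ℝ)⁻¹ * (2 * traceForm d 1 C)
              * (ρ a * (C : Matrix (Fin d) (Fin d) ℂ)).trace.re
            - (d : ℝ)⁻¹ ^ 2 * traceForm d 1 C ^ 2 * (ρ a).trace.re) := fun a => by
    obtain ⟨hre, him⟩ := Complex.pos_iff.mp (hpos a)
    rw [trace_matBar_mul_re him.symm, traceForm_one, div_eq_mul_inv _ (d : ℝ)]
    generalize (d : ℝ)⁻¹ = r
    have := hre.ne'
    field_simp
    ring
  rw [qG, Finset.sum_congr rfl fun a _ => hterm a, Finset.sum_add_distrib,
    Finset.sum_sub_distrib, ← Finset.mul_sum, ← Finset.mul_sum, ← hp, ← ht,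
    traceForm_barCorrection, qGbar]
  ring

/-- For any state assemblage `{ρ_{a|x}}` for `ρ_B`,
`τ({ρ_{a|x}}) = τ̄({ρ_{a|x}}) + tr(ρ_B)/d`. In particular, if `tr(ρ_B) = 1` then
`τ = τ̄ + 1/d`, and for a measurement assemblage (`ρ_B = I`) `τ = τ̄ + 1`. -/
theorem tau_eq_tauBar_add {d m : ℕ} (hd : 1 ≤ d) (hm : 1 ≤ m) {n : Fin m → ℕ}
    (ρ : ∀ x : Fin m, Fin (n x) → Matrix (Fin d) (Fin d) ℂ)
    (hpsd : ∀ x a, (ρ x a).PosSemidef) (h0 : ∀ x a, ρ x a ≠ 0)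
    (ρB : Matrix (Fin d) (Fin d) ℂ) (hsum : ∀ x, ∑ a, ρ x a = ρB) :
    tau ρ = tauBar ρ + ρB.trace.re / d ∧
    (ρB.trace = 1 → tau ρ = tauBar ρ + 1 / d) ∧
    (ρB = 1 → tau ρ = tauBar ρ + 1) := by
  have hpos : ∀ x a, 0 < (ρ x a).trace := fun x a =>
    (hpsd x a).trace_nonneg.lt_of_ne' fun h => h0 x a ((hpsd x a).trace_eq_zero_iff.mp h)
  have hre : ∀ x a, 0 ≤ (ρ x a).trace.re := fun x a => (Complex.pos_iff.mp (hpos x a)).1.le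
  have : Nonempty (Fin m) := ⟨⟨0, hm⟩⟩
  have hherm : ρB.IsHermitian := by
    rw [← hsum ⟨0, hm⟩]
    exact (Matrix.posSemidef_sum _ fun a _ => hpsd _ a).isHermitian
  have key : tau ρ = tauBar ρ + ρB.trace.re / d := by
    rw [← trace_barCorrection hd ⟨ρB, hherm⟩]
    refine tauGen_eq_add (fun X Y => ?_)
      (fun x C => qG_eq_qGbar_add (ρ x) (hpos x) ⟨ρB, hherm⟩ C (hsum x))
      (fun x C => qGbar_nonneg (hre x) C)
      (exists_isDominating_qG (fun x a => ⟨ρ x a, (hpsd x a).isHermitian⟩) hre)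
    rw [traceForm_comm _ Y, traceForm_barCorrection, traceForm_barCorrection]
    ring
  refine ⟨key, fun h => by simpa [h] using key, fun h => ?_⟩
  have hd0 : (d : ℝ) ≠ 0 := by positivity
  simpa [h, hd0] using key
end

section
/- Any measurement assemblage {M_{a|x}} on ℂ^d satisfies τ({M_{a|x}}) ≤ d² and τ̄({M_{a|x}}) ≤ d² − 1. Any state assemblage {ρ_{a|x}} for a matrix ρ_B with tr(ρ_B) = 1 satisfies τ({ρ_{a|x}}) ≤ d and τ̄({ρ_{a|x}}) ≤ d − 1/d. -/
open ComplexOrder Matrix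

open scoped ComplexStarModule

/-- If a `ℂ`-linear map on a complex star module preserves the self-adjoint part, then its trace is
the real trace of its restriction to the self-adjoint part. -/
theorem LinearMap.trace_eq_ofReal_trace_selfAdjoint {A : Type*} [AddCommGroup A] [Module ℂ A]
    [StarAddMonoid A] [StarModule ℂ A] [Module.Finite ℂ A]
    (L : A →ₗ[ℂ] A) (F : selfAdjoint A →ₗ[ℝ] selfAdjoint A)
    (hF : ∀ C : selfAdjoint A, (F C : A) = L C) :
    LinearMap.trace ℂ A L = (LinearMap.trace ℝ (selfAdjoint A) F : ℝ) := by
  have : Module.Finite ℝ A := Module.Finite.trans ℂ A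
  have : Module.Finite ℝ (selfAdjoint A) :=
    Module.Finite.of_surjective (ℜ : A →ₗ[ℝ] selfAdjoint A) realPart_surjective
  let b := Module.finBasis ℝ (selfAdjoint A)
  have hli : LinearIndependent ℂ (fun i => (b i : A)) := by
    rw [Fintype.linearIndependent_iff]
    intro g hg i
    have hb := Fintype.linearIndependent_iff.1 b.linearIndependent
    have hre := congrArg (fun z : A => (ℜ z : selfAdjoint A)) hg
    have him := congrArg (fun z : A => (ℑ z : selfAdjoint A)) hg
    simp only [map_sum, realPart_smul, imaginaryPart_smul, selfAdjoint.realPart_coe,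
      selfAdjoint.imaginaryPart_coe, smul_zero, sub_zero, zero_add, map_zero] at hre him
    exact Complex.ext (hb _ hre i) (hb _ him i)
  have hcoe : ∀ C : selfAdjoint A, (C : A) = ∑ i, ((b.repr C i : ℝ) : ℂ) • (b i : A) := by
    intro C
    conv_lhs => rw [← b.sum_repr C]
    simp only [AddSubgroup.val_finsetSum, selfAdjoint.val_smul, Complex.coe_smul]
  have hmem : ∀ C : selfAdjoint A, (C : A) ∈ Submodule.span ℂ (Set.range fun i => (b i : A)) := by
    intro C
    rw [hcoe C]
    exact Submodule.sum_mem _ fun i _ =>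
      Submodule.smul_mem _ _ (Submodule.subset_span (Set.mem_range_self i))
  have hspan : ⊤ ≤ Submodule.span ℂ (Set.range fun i => (b i : A)) := by
    rw [← span_selfAdjoint, Submodule.span_le]
    exact fun C hC => hmem ⟨C, hC⟩
  let b' := Module.Basis.mk hli hspan
  have hrepr : ∀ (C : selfAdjoint A) i, b'.repr (C : A) i = (b.repr C i : ℝ) := by
    intro C i
    have : (C : A) = ∑ i, ((b.repr C i : ℝ) : ℂ) • b' i := by
      simpa [b'] using hcoe C
    rw [this, b'.repr_sum_self]
  rw [LinearMap.trace_eq_matrix_trace ℂ b', LinearMap.trace_eq_matrix_trace ℝ b]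
  simp only [Matrix.trace, Matrix.diag_apply, LinearMap.toMatrix_apply, Complex.ofReal_sum]
  refine Finset.sum_congr rfl fun i _ => ?_
  rw [← hrepr, hF, Module.Basis.mk_apply]

/-- A symmetric complex-linear superoperator dominating the quadratic forms bounds `tauGen`. -/
theorem tauGen_le_of_linearMap {d : ℕ} {ι : Type} {q : ι → Matrix (Fin d) (Fin d) ℂ → ℝ}
    (L : Matrix (Fin d) (Fin d) ℂ →ₗ[ℂ] Matrix (Fin d) (Fin d) ℂ)
    (hsa : ∀ C, IsSelfAdjoint C → IsSelfAdjoint (L C))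
    (hsymm : ∀ X Y, (X * L Y).trace = (L X * Y).trace)
    (hq : ∀ x C, IsSelfAdjoint C → q x C ≤ (C * L C).trace.re)
    {t : ℝ} (ht : 0 ≤ t) (htr : LinearMap.trace ℂ _ L = t) : tauGen q ≤ t := by
  let F : selfAdjoint (Matrix (Fin d) (Fin d) ℂ) →ₗ[ℝ] selfAdjoint (Matrix (Fin d) (Fin d) ℂ) :=
    ℜ ∘ₗ L.restrictScalars ℝ ∘ₗ (selfAdjoint.submodule ℝ (Matrix (Fin d) (Fin d) ℂ)).subtype
  have hF : ∀ C, (F C : Matrix (Fin d) (Fin d) ℂ) = L C :=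
    fun C => (hsa C C.2).coe_realPart
  have hFtr : LinearMap.trace ℝ _ F = t := by
    rw [L.trace_eq_ofReal_trace_selfAdjoint F hF] at htr
    exact_mod_cast htr
  unfold tauGen
  set S : Set ℝ := _
  change sInf S ≤ t
  by_cases hS : BddBelow S
  · refine csInf_le hS ⟨F, fun X Y => ?_, fun x C => ?_, hFtr⟩
    · rw [hF, hF, hsymm]
    · rw [hF]
      exact hq x C C.2
  · rwa [Real.sInf_of_not_bddBelow hS]

/-- The Jordan multiplication map `C ↦ (BC + CB)/2`. -/
noncomputable def jordanMul {d : ℕ} (B : Matrix (Fin d) (Fin d) ℂ) :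
    Matrix (Fin d) (Fin d) ℂ →ₗ[ℂ] Matrix (Fin d) (Fin d) ℂ :=
  (2⁻¹ : ℂ) • (LinearMap.mulLeft ℂ B + LinearMap.mulRight ℂ B)

/-- `matBar` as a linear map. -/
noncomputable def matBarLin (d : ℕ) :
    Matrix (Fin d) (Fin d) ℂ →ₗ[ℂ] Matrix (Fin d) (Fin d) ℂ :=
  LinearMap.id - ((d : ℂ)⁻¹ • Matrix.traceLinearMap (Fin d) ℂ ℂ).smulRight 1

section

variable {d : ℕ}

theorem jordanMul_apply (B C : Matrix (Fin d) (Fin d) ℂ) :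
    jordanMul B C = (2⁻¹ : ℂ) • (B * C + C * B) := rfl

theorem matBarLin_apply (C : Matrix (Fin d) (Fin d) ℂ) : matBarLin d C = matBar C := by
  simp [matBarLin, matBar, div_eq_inv_mul]

theorem trace_mul_matBar (X Y : Matrix (Fin d) (Fin d) ℂ) :
    (X * matBar Y).trace = (matBar X * Y).trace := by
  simp [matBar, mul_sub, sub_mul, Matrix.trace_sub]
  ring

theorem isSelfAdjoint_matBar {C : Matrix (Fin d) (Fin d) ℂ} (hC : IsSelfAdjoint C) :
    IsSelfAdjoint (matBar C) := by
  have h : star C.trace = C.trace := by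
    rw [← Matrix.trace_conjTranspose, ← Matrix.star_eq_conjTranspose, hC.star_eq]
  have h' : IsSelfAdjoint (C.trace / (d : ℂ)) := by
    rw [IsSelfAdjoint, star_div₀, h, star_natCast]
  exact hC.sub (h'.smul (IsSelfAdjoint.one _))

theorem matBar_matBar (hd : d ≠ 0) (C : Matrix (Fin d) (Fin d) ℂ) :
    matBar (matBar C) = matBar C := by
  have : (d : ℂ) ≠ 0 := Nat.cast_ne_zero.2 hd
  simp [matBar, Matrix.trace_sub, this]

theorem isSelfAdjoint_jordanMul {B C : Matrix (Fin d) (Fin d) ℂ}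
    (hB : IsSelfAdjoint B) (hC : IsSelfAdjoint C) : IsSelfAdjoint (jordanMul B C) := by
  rw [jordanMul_apply, IsSelfAdjoint, star_smul, star_add, star_mul, star_mul, hB.star_eq,
    hC.star_eq, add_comm (C * B)]
  simp

theorem trace_mul_jordanMul (B X Y : Matrix (Fin d) (Fin d) ℂ) :
    (X * jordanMul B Y).trace = (jordanMul B X * Y).trace := by
  simp only [jordanMul_apply, mul_smul_comm, smul_mul_assoc, mul_add, add_mul, Matrix.trace_smul,
    Matrix.trace_add]
  rw [Matrix.mul_assoc B X Y, Matrix.trace_mul_comm B (X * Y), ← mul_assoc, ← mul_assoc, add_comm]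

theorem trace_mul_jordanMul_self (B C : Matrix (Fin d) (Fin d) ℂ) :
    (C * jordanMul B C).trace = (B * (C * C)).trace := by
  simp only [jordanMul_apply, mul_smul_comm, mul_add, Matrix.trace_smul, Matrix.trace_add]
  rw [← mul_assoc C C B, Matrix.trace_mul_comm (C * C) B, ← mul_assoc C B C,
    Matrix.trace_mul_comm (C * B) C, ← mul_assoc C C B, Matrix.trace_mul_comm (C * C) B, smul_eq_mul]
  ring

theorem LinearMap.trace_matrix_eq_sum
    (L : Matrix (Fin d) (Fin d) ℂ →ₗ[ℂ] Matrix (Fin d) (Fin d) ℂ) :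
    LinearMap.trace ℂ _ L = ∑ i, ∑ j, L (Matrix.single i j 1) i j := by
  rw [LinearMap.trace_eq_matrix_trace ℂ (Matrix.stdBasis ℂ (Fin d) (Fin d)), Matrix.trace,
    Fintype.sum_prod_type]
  refine Finset.sum_congr rfl fun i _ => Finset.sum_congr rfl fun j _ => ?_
  rw [Matrix.diag_apply, LinearMap.toMatrix_apply, Matrix.stdBasis_eq_single]
  rfl

theorem trace_jordanMul (B : Matrix (Fin d) (Fin d) ℂ) :
    LinearMap.trace ℂ _ (jordanMul B) = d * B.trace := by
  rw [LinearMap.trace_matrix_eq_sum]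
  simp [jordanMul_apply, Finset.sum_add_distrib, ← Finset.mul_sum, Matrix.trace]
  ring

theorem trace_matBarLin_comp_jordanMul (hd : d ≠ 0) (B : Matrix (Fin d) (Fin d) ℂ) :
    LinearMap.trace ℂ _ (matBarLin d ∘ₗ jordanMul B ∘ₗ matBarLin d)
      = d * B.trace - B.trace / d := by
  have h1 : matBarLin d ∘ₗ matBarLin d = matBarLin d :=
    LinearMap.ext fun C => by simp [matBarLin_apply, matBar_matBar hd]
  have h2 : jordanMul B ∘ₗ matBarLin d
      = jordanMul B - ((d : ℂ)⁻¹ • Matrix.traceLinearMap (Fin d) ℂ ℂ).smulRight B := by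
    refine LinearMap.ext fun C => ?_
    simp only [LinearMap.comp_apply, LinearMap.sub_apply, matBarLin_apply, matBar, map_sub,
      map_smul, LinearMap.smulRight_apply, LinearMap.smul_apply, Matrix.traceLinearMap_apply]
    rw [jordanMul_apply B 1, mul_one, one_mul, ← two_smul ℂ B, inv_smul_smul₀ two_ne_zero,
      div_eq_inv_mul, smul_eq_mul]
  rw [LinearMap.trace_comp_comm', LinearMap.comp_assoc, h1, h2, map_sub, trace_jordanMul,
    LinearMap.trace_smulRight]
  simp [div_eq_inv_mul]

theorem sq_trace_div_le {A C : Matrix (Fin d) (Fin d) ℂ} (hA : A.PosSemidef)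
    (hC : IsSelfAdjoint C) :
    (A * C).trace.re ^ 2 / A.trace.re ≤ (A * (C * C)).trace.re := by
  have key : ∀ D : Matrix (Fin d) (Fin d) ℂ, IsSelfAdjoint D → 0 ≤ (A * (D * D)).trace.re := by
    intro D hD
    have h := (hA.conjTranspose_mul_mul_same D).trace_nonneg
    rw [← Matrix.star_eq_conjTranspose, hD.star_eq, Matrix.trace_mul_comm, ← mul_assoc,
      Matrix.trace_mul_comm] at h
    exact (Complex.le_def.1 h).1
  have hexp : ∀ s : ℝ, 0 ≤ (A * (C * C)).trace.re - 2 * s * (A * C).trace.re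
      + s ^ 2 * A.trace.re := by
    intro s
    have hs : IsSelfAdjoint (C - (s : ℝ) • (1 : Matrix (Fin d) (Fin d) ℂ)) :=
      hC.sub ((IsSelfAdjoint.all s).smul (IsSelfAdjoint.one _))
    have h := key _ hs
    simp only [mul_sub, sub_mul, mul_smul_comm, smul_mul_assoc, mul_one, one_mul,
      Matrix.trace_sub, Matrix.trace_smul, Complex.sub_re, Complex.smul_re, smul_eq_mul] at h
    linarith
  rcases eq_or_ne A.trace.re 0 with h0 | h0
  · simpa [h0] using key C hC
  · have h := hexp ((A * C).trace.re / A.trace.re)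
    have e : (A * (C * C)).trace.re - 2 * ((A * C).trace.re / A.trace.re) * (A * C).trace.re
        + ((A * C).trace.re / A.trace.re) ^ 2 * A.trace.re
        = (A * (C * C)).trace.re - (A * C).trace.re ^ 2 / A.trace.re := by
      field_simp
      ring
    rw [e] at h
    linarith

theorem qG_le {n : ℕ} {ρ : Fin n → Matrix (Fin d) (Fin d) ℂ} (hρ : ∀ a, (ρ a).PosSemidef)
    {C : Matrix (Fin d) (Fin d) ℂ} (hC : IsSelfAdjoint C) :
    qG ρ C ≤ ((∑ a, ρ a) * (C * C)).trace.re := by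
  rw [Finset.sum_mul, Matrix.trace_sum, Complex.re_sum]
  exact Finset.sum_le_sum fun a _ => sq_trace_div_le (hρ a) hC

theorem qGbar_eq_qG_matBar {n : ℕ} (ρ : Fin n → Matrix (Fin d) (Fin d) ℂ)
    (C : Matrix (Fin d) (Fin d) ℂ) : qGbar ρ C = qG ρ (matBar C) := by
  simp [qGbar, qG, trace_mul_matBar]

theorem tau_le_and_tauBar_le_of_trace_eq {m : ℕ} (hd : 1 ≤ d) {n : Fin m → ℕ}
    {ρ : ∀ x : Fin m, Fin (n x) → Matrix (Fin d) (Fin d) ℂ}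
    (hpsd : ∀ x a, (ρ x a).PosSemidef) {B : Matrix (Fin d) (Fin d) ℂ} (hB : IsSelfAdjoint B)
    (hsum : ∀ x, ∑ a, ρ x a = B) {t : ℝ} (ht : 0 ≤ t) (htr : B.trace = t) :
    tau ρ ≤ d * t ∧ tauBar ρ ≤ d * t - t / d := by
  have hd0 : d ≠ 0 := by omega
  have hd1 : (1 : ℝ) ≤ d := by exact_mod_cast hd
  constructor
  · refine tauGen_le_of_linearMap (jordanMul B) (fun C hC => isSelfAdjoint_jordanMul hB hC)
      (trace_mul_jordanMul B) (fun x C hC => ?_) (by positivity)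
      (by rw [trace_jordanMul, htr]; push_cast; rfl)
    rw [trace_mul_jordanMul_self, ← hsum x]
    exact qG_le (hpsd x) hC
  · refine tauGen_le_of_linearMap (matBarLin d ∘ₗ jordanMul B ∘ₗ matBarLin d)
      (fun C hC => ?_) (fun X Y => ?_) (fun x C hC => ?_) ?_
      (by rw [trace_matBarLin_comp_jordanMul hd0, htr]; push_cast; rfl)
    · simp only [LinearMap.comp_apply, matBarLin_apply]
      exact isSelfAdjoint_matBar (isSelfAdjoint_jordanMul hB (isSelfAdjoint_matBar hC))
    · simp only [LinearMap.comp_apply, matBarLin_apply]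
      rw [trace_mul_matBar, trace_mul_jordanMul, ← trace_mul_matBar]
    · simp only [LinearMap.comp_apply, matBarLin_apply]
      rw [trace_mul_matBar, trace_mul_jordanMul_self, ← hsum x, qGbar_eq_qG_matBar]
      exact qG_le (hpsd x) (isSelfAdjoint_matBar hC)
    · have : t / d ≤ t := div_le_self ht hd1
      nlinarith

end

/-- Universal upper bounds: any measurement assemblage (`ρ_B = I`) satisfies
`τ ≤ d²` and `τ̄ ≤ d² − 1`; any state assemblage (`tr(ρ_B) = 1`) satisfies
`τ ≤ d` and `τ̄ ≤ d − 1/d`. -/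
theorem tau_global_bounds {d m : ℕ} (hd : 1 ≤ d) {n : Fin m → ℕ}
    (ρ : ∀ x : Fin m, Fin (n x) → Matrix (Fin d) (Fin d) ℂ)
    (hpsd : ∀ x a, (ρ x a).PosSemidef) (h0 : ∀ x a, ρ x a ≠ 0)
    (ρB : Matrix (Fin d) (Fin d) ℂ) (hsum : ∀ x, ∑ a, ρ x a = ρB) :
    (ρB = 1 → tau ρ ≤ (d : ℝ) ^ 2 ∧ tauBar ρ ≤ (d : ℝ) ^ 2 - 1) ∧
    (ρB.trace = 1 → tau ρ ≤ d ∧ tauBar ρ ≤ d - 1 / d) := by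
  have hd0 : (d : ℝ) ≠ 0 := by
    have : d ≠ 0 := by omega
    exact_mod_cast this
  constructor
  · rintro rfl
    have h := tau_le_and_tauBar_le_of_trace_eq hd hpsd (IsSelfAdjoint.one _) hsum
      (Nat.cast_nonneg d) (by simp)
    rwa [div_self hd0, ← pow_two] at h
  · intro htr
    rcases m.eq_zero_or_pos with rfl | hm
    · have h := tau_le_and_tauBar_le_of_trace_eq hd hpsd
        (B := (d : ℝ)⁻¹ • (1 : Matrix (Fin d) (Fin d) ℂ))
        ((IsSelfAdjoint.all _).smul (IsSelfAdjoint.one _)) (fun x => x.elim0) zero_le_one (by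
          have : (d : ℂ) ≠ 0 := by exact_mod_cast hd0
          simp [this])
      rwa [mul_one] at h
    · have hB : IsSelfAdjoint ρB := by
        rw [← hsum ⟨0, hm⟩]
        exact isSelfAdjoint_sum _ fun a _ => (hpsd _ a).isHermitian
      have h := tau_le_and_tauBar_le_of_trace_eq hd hpsd hB hsum zero_le_one (by simpa using htr)
      rwa [mul_one] at h
end
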